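/- Let q be a prime power and S a surface of degree d in P^3 over F_q without F_q-plane components, with 2 ≤ d ≤ q+1 and N_q(S) = (d-1)q^2 + dq + 1. If l is an F_q-line contained in S and H is an F_q-plane containing l, then S ∩ H is a planar F_q-pencil of degree d. -/

import Mathlib

open MvPolynomial

variable {K : Type} [Field K]

/-- The linear form `∑ aᵢ Xᵢ` as a multivariate polynomial. -/
noncomputable def linForm {n : ℕ} (a : Fin n → K) : MvPolynomial (Fin n) K :=
  ∑ i, C (a i) * X i

/-- The linear form `v ↦ ∑ aᵢ vᵢ` as a linear map. -/
noncomputable def linMap {n : ℕ} (a : Fin n → K) : (Fin n → K) →ₗ[K] K :=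
  ∑ i, a i • LinearMap.proj i

/-- Substitution `F(M·X)` of a linear change of variables into `F`. -/
noncomputable def substLin {n : ℕ} (M : Matrix (Fin n) (Fin n) K)
    (F : MvPolynomial (Fin n) K) : MvPolynomial (Fin n) K :=
  MvPolynomial.aeval (fun i => ∑ j, C (M i j) * X j) F

/-- Projective equivalence over `K` of two forms. -/
def ProjEquiv {n : ℕ} (F G : MvPolynomial (Fin n) K) : Prop :=
  ∃ M : Matrix (Fin n) (Fin n) K, IsUnit M.det ∧
    ∃ c : K, c ≠ 0 ∧ substLin M F = C c * G

/-- An `F_q`-line in `P^3` (resp. `P^2`), as a 2-dimensional linear subspace. -/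
def IsLine {n : ℕ} (W : Submodule K (Fin n → K)) : Prop := Module.finrank K W = 2

/-- An `F_q`-plane in `P^3`, as a 3-dimensional linear subspace. -/
def IsPlane (W : Submodule K (Fin 4 → K)) : Prop := Module.finrank K W = 3

/-- The section `S ∩ H` of the surface `S = {F = 0}` with the plane `H` given by the
subspace `W` is a planar `F_q`-pencil of degree `d` with vertex `P`: modulo the linear
form defining `H`, `F` is a nonzero scalar times a product of `d` linear forms over `F_q`
cutting out `d` pairwise distinct lines of `H`, all passing through the point `P`. -/
def IsPencil (F : MvPolynomial (Fin 4) K) (d : ℕ)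
    (W : Submodule K (Fin 4 → K)) (P : Projectivization K (Fin 4 → K)) : Prop :=
  ∃ (a : Fin 4 → K) (m : Fin d → Fin 4 → K) (c : K) (g : MvPolynomial (Fin 4) K),
    a ≠ 0 ∧ W = LinearMap.ker (linMap a) ∧ c ≠ 0 ∧
    F = C c * (∏ i, linForm (m i)) + linForm a * g ∧
    (∀ i, IsLine (LinearMap.ker (linMap a) ⊓ LinearMap.ker (linMap (m i)))) ∧
    (∀ i j, i ≠ j →
      LinearMap.ker (linMap a) ⊓ LinearMap.ker (linMap (m i)) ≠
      LinearMap.ker (linMap a) ⊓ LinearMap.ker (linMap (m j))) ∧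
    P.rep ∈ W ∧ (∀ i, linMap (m i) P.rep = 0)

/-- The restriction of `F` to the plane `H` given by the subspace `W` has a linear
factor over `F_q` (i.e. the section `S ∩ H` has an `F_q`-line component). -/
def SectionHasLineComp (F : MvPolynomial (Fin 4) K)
    (W : Submodule K (Fin 4 → K)) : Prop :=
  ∃ (a b : Fin 4 → K) (h g : MvPolynomial (Fin 4) K),
    a ≠ 0 ∧ W = LinearMap.ker (linMap a) ∧
    IsLine (LinearMap.ker (linMap a) ⊓ LinearMap.ker (linMap b)) ∧
    F = linForm b * h + linForm a * g

section LinearSubstitution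

variable {n k r : ℕ}

lemma linMap_apply (a v : Fin n → K) : linMap a v = ∑ i, a i * v i := by
  simp [linMap]

lemma linMap_single (φ : (Fin n → K) →ₗ[K] K) : linMap (fun i => φ (Pi.single i 1)) = φ := by
  refine LinearMap.pi_ext' fun i => LinearMap.ext_ring ?_
  simp [linMap_apply, Pi.single_apply]

lemma linMap_eq_zero {a : Fin n → K} : linMap a = 0 ↔ a = 0 := by
  constructor
  · intro h
    ext i
    simpa [linMap_apply, Pi.single_apply] using LinearMap.congr_fun h (Pi.single i 1)
  · rintro rfl
    ext
    simp [linMap_apply]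

lemma eval_linForm (a v : Fin n → K) : eval v (linForm a) = linMap a v := by
  simp [linForm, linMap_apply]

lemma isHomogeneous_linForm (a : Fin n → K) : (linForm a).IsHomogeneous 1 :=
  IsHomogeneous.sum _ _ _ fun _ _ => isHomogeneous_C_mul_X _ _

/-- The coefficient vector of a linear functional. -/
def coeffVec (φ : (Fin n → K) →ₗ[K] K) : Fin n → K := fun i => φ (Pi.single i 1)

lemma linMap_coeffVec (φ : (Fin n → K) →ₗ[K] K) : linMap (coeffVec φ) = φ := linMap_single φ

/-- Substitution of a linear map into a polynomial. -/
noncomputable def pull (T : (Fin k → K) →ₗ[K] (Fin n → K)) :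
    MvPolynomial (Fin n) K →ₐ[K] MvPolynomial (Fin k) K :=
  aeval fun i => linForm (coeffVec (LinearMap.proj i ∘ₗ T))

lemma pull_X (T : (Fin k → K) →ₗ[K] (Fin n → K)) (i : Fin n) :
    pull T (X i) = linForm (coeffVec (LinearMap.proj i ∘ₗ T)) := by
  simp [pull]

lemma eval_pull (T : (Fin k → K) →ₗ[K] (Fin n → K)) (F : MvPolynomial (Fin n) K) (x : Fin k → K) :
    eval x (pull T F) = eval (T x) F := by
  have h : (aeval x : _ →ₐ[K] K).comp (pull T) = aeval (T x) := by
    refine algHom_ext fun i => ?_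
    rw [AlgHom.comp_apply, pull_X, aeval_eq_eval, eval_linForm, linMap_coeffVec]
    simp
  simpa [aeval_eq_eval] using AlgHom.congr_fun h F

lemma isHomogeneous_pull (T : (Fin k → K) →ₗ[K] (Fin n → K)) {F : MvPolynomial (Fin n) K} {d : ℕ}
    (hF : F.IsHomogeneous d) : (pull T F).IsHomogeneous d := by
  have h := hF.aeval (fun i => linForm (coeffVec (LinearMap.proj i ∘ₗ T)))
    fun i => isHomogeneous_linForm _
  rwa [one_mul] at h

lemma pull_linForm (T : (Fin k → K) →ₗ[K] (Fin n → K)) (a : Fin n → K) :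
    pull T (linForm a) = linForm (coeffVec (linMap a ∘ₗ T)) := by
  conv_lhs => rw [linForm]
  simp only [map_sum, map_mul, pull_X, algHom_C, algebraMap_eq, linForm, Finset.mul_sum]
  rw [Finset.sum_comm]
  refine Finset.sum_congr rfl fun j _ => ?_
  simp [coeffVec, linMap_apply, map_sum, Finset.sum_mul, mul_assoc]

lemma pull_pull (T : (Fin k → K) →ₗ[K] (Fin n → K)) (S : (Fin r → K) →ₗ[K] (Fin k → K))
    (F : MvPolynomial (Fin n) K) : pull S (pull T F) = pull (T ∘ₗ S) F := by
  have h : (pull S).comp (pull T) = pull (T ∘ₗ S) := by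
    refine algHom_ext fun i => ?_
    rw [AlgHom.comp_apply, pull_X, pull_X, pull_linForm, linMap_coeffVec, LinearMap.comp_assoc]
  exact AlgHom.congr_fun h F

lemma linForm_dvd_sub_pull {a : Fin n → K} {T : (Fin k → K) →ₗ[K] (Fin n → K)}
    {S : (Fin n → K) →ₗ[K] (Fin k → K)} {e : Fin n → K}
    (h : ∀ x, x - T (S x) = linMap a x • e) (F : MvPolynomial (Fin n) K) :
    linForm a ∣ F - pull S (pull T F) := by
  rw [pull_pull, ← Ideal.mem_span_singleton, ← Ideal.Quotient.eq]
  have h' : (Ideal.Quotient.mkₐ K (Ideal.span {linForm a})) =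
      (Ideal.Quotient.mkₐ K (Ideal.span {linForm a})).comp (pull (T ∘ₗ S)) := by
    refine algHom_ext fun i => ?_
    rw [AlgHom.comp_apply, Ideal.Quotient.mkₐ_eq_mk, Ideal.Quotient.eq, Ideal.mem_span_singleton,
      pull_X]
    refine ⟨C (e i), ?_⟩
    have hX : (X i : MvPolynomial (Fin n) K) = linForm (coeffVec (LinearMap.proj i)) := by
      simp [linForm, coeffVec, Pi.single_apply]
    rw [hX, linForm, linForm, linForm, ← Finset.sum_sub_distrib, Finset.sum_mul]
    refine Finset.sum_congr rfl fun j _ => ?_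
    rw [← sub_mul, ← C_sub, mul_right_comm, ← C_mul]
    congr 2
    have := congrFun (h (Pi.single j 1)) i
    simpa [coeffVec, linMap_apply, Pi.single_apply] using this
  exact AlgHom.congr_fun h' F

lemma exists_eq_ker_linMap {W : Submodule K (Fin n → K)} (hW : Module.finrank K W = k)
    (hk : k + 1 = n) : ∃ a : Fin n → K, a ≠ 0 ∧ W = LinearMap.ker (linMap a) := by
  have hlt : W < ⊤ := by
    refine lt_top_iff_ne_top.2 ?_
    rintro rfl
    simp at hW
    omega
  obtain ⟨φ, hφ, hWφ⟩ := Submodule.exists_le_ker_of_lt_top W hlt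
  refine ⟨coeffVec φ, by rwa [Ne, ← linMap_eq_zero, linMap_coeffVec], ?_⟩
  rw [linMap_coeffVec]
  refine Submodule.eq_of_le_of_finrank_le hWφ ?_
  have h1 := LinearMap.finrank_range_add_finrank_ker φ
  have h2 : LinearMap.range φ = ⊤ := LinearMap.range_eq_top.2 (LinearMap.surjective hφ)
  rw [h2] at h1
  simp at h1
  omega

/-- A parametrization of a hyperplane together with a compatible retraction. -/
lemma exists_hyperplane_param {a : Fin n → K} (ha : a ≠ 0)
    (hk : Module.finrank K (LinearMap.ker (linMap a)) = k) :
    ∃ (T : (Fin k → K) →ₗ[K] (Fin n → K)) (S : (Fin n → K) →ₗ[K] (Fin k → K)) (e : Fin n → K),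
      LinearMap.range T = LinearMap.ker (linMap a) ∧ (∀ x, S (T x) = x) ∧
      ∀ x, x - T (S x) = linMap a x • e := by
  set W := LinearMap.ker (linMap a) with hW
  let u : (Fin k → K) ≃ₗ[K] W := LinearEquiv.ofFinrankEq _ _ (by simp [hk])
  let T : (Fin k → K) →ₗ[K] (Fin n → K) := W.subtype ∘ₗ u.toLinearMap
  have hTr : LinearMap.range T = W := by
    simp [T, LinearMap.range_comp]
  obtain ⟨S, hS⟩ := T.exists_leftInverse_of_injective
    (LinearMap.ker_eq_bot.2 (W.injective_subtype.comp u.injective))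
  have hST : ∀ x, S (T x) = x := fun x => LinearMap.congr_fun hS x
  obtain ⟨e, he⟩ := LinearMap.surjective (fun h => ha (linMap_eq_zero.1 h)) 1
  refine ⟨T, S, e - T (S e), hTr, hST, fun x => ?_⟩
  have hx : x - linMap a x • e ∈ LinearMap.range T := by
    rw [hTr, hW]
    simp [he]
  obtain ⟨y, hy⟩ := hx
  have h1 : T (S (x - linMap a x • e)) = x - linMap a x • e := by rw [← hy, hST]
  simp only [map_sub, map_smul] at h1
  rw [smul_sub, sub_eq_sub_iff_sub_eq_sub.1 h1.symm |>.symm]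

lemma linForm_dvd_of_pull_eq_zero {a : Fin n → K} {T : (Fin k → K) →ₗ[K] (Fin n → K)}
    {S : (Fin n → K) →ₗ[K] (Fin k → K)} {e : Fin n → K}
    (h : ∀ x, x - T (S x) = linMap a x • e) {F : MvPolynomial (Fin n) K} (hF : pull T F = 0) :
    linForm a ∣ F := by
  simpa [hF] using linForm_dvd_sub_pull h F

/-- A form vanishing identically on a parametrized hyperplane is divisible by its equation. -/
lemma exists_linForm_dvd (T : (Fin k → K) →ₗ[K] (Fin n → K)) (hT : Function.Injective T)
    (hk : k + 1 = n) {F : MvPolynomial (Fin n) K} (hF : pull T F = 0) :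
    ∃ a : Fin n → K, a ≠ 0 ∧ (∀ x, linMap a (T x) = 0) ∧ linForm a ∣ F := by
  have hfin : Module.finrank K (LinearMap.range T) = k := by
    rw [LinearMap.finrank_range_of_inj hT]; simp
  obtain ⟨a, ha, hW⟩ := exists_eq_ker_linMap hfin hk
  obtain ⟨T', S, e, hr, -, h⟩ := exists_hyperplane_param ha (hW ▸ hfin)
  rw [← hW] at hr
  obtain ⟨R, hR⟩ : ∃ R : (Fin k → K) →ₗ[K] (Fin k → K), T' = T ∘ₗ R := by
    obtain ⟨L, hL⟩ := T.exists_leftInverse_of_injective (LinearMap.ker_eq_bot.2 hT)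
    refine ⟨L ∘ₗ T', LinearMap.ext fun x => ?_⟩
    obtain ⟨y, hy⟩ : T' x ∈ LinearMap.range T := hr ▸ LinearMap.mem_range_self T' x
    have := LinearMap.congr_fun hL y
    simp only [LinearMap.comp_apply, LinearMap.id_apply] at this ⊢
    rw [← hy, this]
  refine ⟨a, ha, fun x => ?_, linForm_dvd_of_pull_eq_zero h ?_⟩
  · have : T x ∈ LinearMap.ker (linMap a) := hW ▸ LinearMap.mem_range_self T x
    simpa using this
  · rw [hR, ← pull_pull, hF, map_zero]

end LinearSubstitution

section Fibres

variable {n d : ℕ}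

/-- The univariate polynomial obtained by fixing all variables but the first one. -/
noncomputable def fibre (F : MvPolynomial (Fin (n + 1)) K) (w : Fin n → K) : Polynomial K :=
  (finSuccEquiv K n F).map (eval w)

lemma eval_fibre (F : MvPolynomial (Fin (n + 1)) K) (w : Fin n → K) (t : K) :
    (fibre F w).eval t = eval (Fin.cons t w : Fin (n + 1) → K) F :=
  (eval_eq_eval_mv_eval' w t F).symm

lemma fibre_eq_aeval (F : MvPolynomial (Fin (n + 1)) K) (w : Fin n → K) :
    fibre F w = aeval (Fin.cons Polynomial.X fun i => Polynomial.C (w i) :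
      Fin (n + 1) → Polynomial K) F := by
  induction F using MvPolynomial.induction_on with
  | C a => simp [fibre, finSuccEquiv_apply]
  | add p q hp hq => simp only [map_add, ← hp, ← hq]; simp [fibre]
  | mul_X p i hp =>
    simp only [map_mul, ← hp, aeval_X]
    cases i using Fin.cases <;> simp [fibre, finSuccEquiv_X_zero, finSuccEquiv_X_succ]

/-- The parametrization `(t, s) ↦ t • e₀ + s • (0, w)`. -/
def lineParam (w : Fin n → K) : (Fin 2 → K) →ₗ[K] (Fin (n + 1) → K) :=
  (LinearMap.proj 0).smulRight (Fin.cons 1 0 : Fin (n + 1) → K) +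
    (LinearMap.proj 1).smulRight (Fin.cons 0 w : Fin (n + 1) → K)

lemma lineParam_injective {w : Fin n → K} (hw : w ≠ 0) : Function.Injective (lineParam w) := by
  rw [← LinearMap.ker_eq_bot, LinearMap.ker_eq_bot']
  intro y hy
  have h0 := congrFun hy 0
  obtain ⟨i, hi⟩ := Function.ne_iff.1 hw
  have h1 := congrFun hy i.succ
  simp [lineParam] at h0 h1 hi
  ext j
  fin_cases j
  · exact h0
  · simpa [hi] using h1

lemma fibre_pull_lineParam (F : MvPolynomial (Fin (n + 1)) K) (w : Fin n → K) :
    fibre (pull (lineParam w) F) (fun _ => 1) = fibre F w := by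
  rw [fibre_eq_aeval, fibre_eq_aeval]
  have h : (aeval (Fin.cons Polynomial.X fun _ => Polynomial.C 1 :
      Fin 2 → Polynomial K)).comp (pull (lineParam w)) =
      aeval (Fin.cons Polynomial.X fun i => Polynomial.C (w i) :
        Fin (n + 1) → Polynomial K) := by
    refine algHom_ext fun i => ?_
    rw [AlgHom.comp_apply, pull_X]
    cases i using Fin.cases <;> simp [linForm, coeffVec, lineParam, Fin.sum_univ_two]
  exact AlgHom.congr_fun h F

lemma coeff_finSuccEquiv_eq_zero {F : MvPolynomial (Fin (n + 1)) K} (hF : F.IsHomogeneous d)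
    {k : ℕ} (hk : d < k) : (finSuccEquiv K n F).coeff k = 0 := by
  by_contra h
  have h1 := totalDegree_coeff_finSuccEquiv_add_le F k h
  have h2 := hF.totalDegree_le
  omega

lemma eq_zero_of_eval_one {c : MvPolynomial (Fin 1) K} (hc : c.IsHomogeneous d)
    (h : eval (fun _ => 1) c = 0) : c = 0 := by
  ext δ
  by_contra hδ
  rw [coeff_zero] at hδ
  rw [eval_eq] at h
  simp only [one_pow, Finset.prod_const_one, mul_one] at h
  rw [Finset.sum_eq_single δ] at h
  · exact hδ h
  · intro b hb hbδ
    refine absurd ?_ hbδ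
    have h1 := hc.coeff_eq_zero (d := b)
    have h2 := hc.coeff_eq_zero (d := δ)
    rw [not_imp_comm] at h1 h2
    have h3 := (h1 (by simpa using hb)).trans (h2 hδ).symm
    simp [Finsupp.degree_eq_sum] at h3
    ext
    exact h3
  · intro h'
    simpa using h'

lemma binary_eq_zero {F : MvPolynomial (Fin 2) K} (hF : F.IsHomogeneous d)
    (h : fibre F (fun _ => 1) = 0) : F = 0 := by
  apply (finSuccEquiv K 1).injective
  rw [map_zero]
  ext1 k
  rw [Polynomial.coeff_zero]
  rcases lt_or_ge d k with hk | hk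
  · exact coeff_finSuccEquiv_eq_zero hF hk
  · refine eq_zero_of_eval_one (hF.finSuccEquiv_coeff_isHomogeneous k (d - k) (by omega)) ?_
    simpa [fibre] using congrArg (fun p => p.coeff k) h

lemma pull_lineParam_eq_zero {F : MvPolynomial (Fin (n + 1)) K} (hF : F.IsHomogeneous d)
    {w : Fin n → K} (h : fibre F w = 0) : pull (lineParam w) F = 0 :=
  binary_eq_zero (isHomogeneous_pull _ hF) (by rw [fibre_pull_lineParam, h])

lemma coeff_fibre_of_lt {F : MvPolynomial (Fin (n + 1)) K} (hF : F.IsHomogeneous d)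
    (w : Fin n → K) {k : ℕ} (hk : d < k) : (fibre F w).coeff k = 0 := by
  simp [fibre, coeff_finSuccEquiv_eq_zero hF hk]

lemma coeff_fibre_top {F : MvPolynomial (Fin (n + 1)) K} (hF : F.IsHomogeneous d)
    (w : Fin n → K) : (fibre F w).coeff d = eval (Fin.cons 1 0 : Fin (n + 1) → K) F := by
  obtain ⟨c, hc⟩ : ∃ c, (finSuccEquiv K n F).coeff d = C c :=
    ⟨_, totalDegree_eq_zero_iff_eq_C.1
      (Nat.le_zero.1 (hF.finSuccEquiv_coeff_isHomogeneous d 0 (by simp)).totalDegree_le)⟩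
  have hfib : fibre F 0 = Polynomial.C c * Polynomial.X ^ d := by
    ext k
    rw [Polynomial.coeff_C_mul_X_pow]
    split_ifs with hk
    · simp [fibre, hk, hc]
    · rcases lt_or_gt_of_ne hk with hk | hk
      · have h := hF.finSuccEquiv_coeff_isHomogeneous k (d - k) (by omega)
        rw [fibre, Polynomial.coeff_map, eval_zero, constantCoeff_eq]
        apply h.coeff_eq_zero
        simp
        omega
      · exact coeff_fibre_of_lt hF 0 hk
  rw [← eval_fibre, hfib]
  simp [fibre, hc]

lemma exists_eq_linForm {c : MvPolynomial (Fin n) K} (hc : c.IsHomogeneous 1) :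
    ∃ a, c = linForm a := by
  have h : c ∈ homogeneousSubmodule (Fin n) K 1 := hc
  rw [homogeneousSubmodule_one_eq_span_X, Submodule.mem_span_range_iff_exists_fun] at h
  obtain ⟨a, ha⟩ := h
  exact ⟨a, by simp [← ha, linForm, smul_eq_C_mul]⟩

lemma exists_ne_zero_eval_eq_zero {c : MvPolynomial (Fin 2) K} (hc : c.IsHomogeneous 1) :
    ∃ w ≠ 0, eval w c = 0 := by
  obtain ⟨a, rfl⟩ := exists_eq_linForm hc
  by_cases ha : a = 0
  · subst ha
    exact ⟨1, one_ne_zero, by simp [linForm]⟩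
  · refine ⟨![a 1, -a 0], fun h => ha ?_, ?_⟩
    · have h0 := congrFun h 0
      have h1 := congrFun h 1
      ext i
      fin_cases i <;> simp_all
    · simp [eval_linForm, linMap_apply, Fin.sum_univ_two]
      ring

end Fibres

section TernaryForms

variable [Fintype K] {n d : ℕ}

open Classical in
/-- The affine zero set over `K`. -/
noncomputable def zeros (F : MvPolynomial (Fin n) K) : Finset (Fin n → K) :=
  Finset.univ.filter fun v => eval v F = 0

@[simp]
lemma mem_zeros {F : MvPolynomial (Fin n) K} {v : Fin n → K} : v ∈ zeros F ↔ eval v F = 0 := by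
  simp [zeros]

lemma card_fibre_zeros_le [DecidableEq K] {F : MvPolynomial (Fin (n + 1)) K} {w : Fin n → K}
    (h : fibre F w ≠ 0) :
    ((zeros F).filter fun v => Fin.tail v = w).card ≤ (fibre F w).natDegree := by
  refine le_trans ?_ ((Multiset.toFinset_card_le _).trans (Polynomial.card_roots' (fibre F w)))
  refine Finset.card_le_card_of_injOn (fun v => v 0) ?_ ?_
  · intro v hv
    simp only [Finset.mem_coe, Finset.mem_filter, mem_zeros] at hv
    obtain ⟨hv, rfl⟩ := hv
    simp [h, eval_fibre, hv]
  · intro v hv v' hv' h0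
    simp only [Finset.mem_coe, Finset.mem_filter, mem_zeros] at hv hv'
    rw [← Fin.cons_self_tail v, ← Fin.cons_self_tail v', hv.2, hv'.2]
    simp only at h0
    rw [h0]

/-- A ternary form of degree `d ≤ q + 1` with at least `d q + 1` rational points, one of which is
`(1 : 0 : 0)`, vanishes identically on a line through that point. -/
lemma exists_fibre_eq_zero {F : MvPolynomial (Fin 3) K} (hF : F.IsHomogeneous d) (hd : 1 ≤ d)
    (hdq : d ≤ Fintype.card K + 1) (h0 : eval (Fin.cons 1 0 : Fin 3 → K) F = 0)
    (hcard : d * Fintype.card K ^ 2 + Fintype.card K ≤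
      (zeros F).card + d * Fintype.card K) :
    ∃ w ≠ 0, fibre F w = 0 := by
  classical
  by_contra! hne
  obtain ⟨w₀, hw₀, hw₀'⟩ := exists_ne_zero_eval_eq_zero
    (hF.finSuccEquiv_coeff_isHomogeneous (d - 1) 1 (by omega))
  have hle : ∀ w, w ≠ 0 → (fibre F w).natDegree ≤ d - 1 := by
    intro w _
    rw [Polynomial.natDegree_le_iff_coeff_eq_zero]
    intro k hk
    rcases (show d ≤ k by omega).eq_or_lt with rfl | hk'
    · rw [coeff_fibre_top hF, h0]
    · exact coeff_fibre_of_lt hF w hk'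
  have hlt : (fibre F w₀).natDegree < d - 1 := by
    refine lt_of_le_of_ne (hle _ hw₀) fun h => hne w₀ hw₀ ?_
    rw [← Polynomial.leadingCoeff_eq_zero, Polynomial.leadingCoeff, h]
    simpa [fibre] using hw₀'
  have hsum : (zeros F).card = ∑ w, ((zeros F).filter fun v => Fin.tail v = w).card :=
    Finset.card_eq_sum_card_fiberwise fun v _ => by simp
  have hzero : ((zeros F).filter fun v => Fin.tail v = 0).card ≤ Fintype.card K := by
    rw [← Finset.card_univ]
    refine Finset.card_le_card_of_injOn (fun v => v 0) (by simp) ?_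
    intro v hv v' hv' h
    simp only [Finset.mem_coe, Finset.mem_filter, mem_zeros] at hv hv' h
    rw [← Fin.cons_self_tail v, ← Fin.cons_self_tail v', hv.2, hv'.2, h]
  rw [← Finset.add_sum_erase _ _ (Finset.mem_univ 0)] at hsum
  have hlt' : ∑ w ∈ Finset.univ.erase 0, ((zeros F).filter fun v => Fin.tail v = w).card <
      ∑ _w ∈ Finset.univ.erase (0 : Fin 2 → K), (d - 1) := by
    refine Finset.sum_lt_sum (fun w hw => ?_) ⟨w₀, by simp [hw₀], ?_⟩
    · have hw := Finset.ne_of_mem_erase hw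
      exact (card_fibre_zeros_le (hne w hw)).trans (hle w hw)
    · exact (card_fibre_zeros_le (hne w₀ hw₀)).trans_lt hlt
  rw [Finset.sum_const, Finset.card_erase_of_mem (Finset.mem_univ _), Finset.card_univ] at hlt'
  simp only [Fintype.card_fun, Fintype.card_fin, smul_eq_mul] at hlt'
  have hq : 1 ≤ Fintype.card K := Fintype.card_pos
  generalize Fintype.card K = q at *
  obtain ⟨c, rfl⟩ := Nat.exists_eq_add_of_le' hq
  obtain ⟨e, rfl⟩ := Nat.exists_eq_add_of_le' hd
  have h1 : (c + 1) ^ 2 - 1 = c ^ 2 + 2 * c := by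
    rw [Nat.sub_eq_of_eq_add]; ring
  rw [h1] at hlt'
  simp only [Nat.add_sub_cancel] at hlt'
  have h2 : c * e ≤ c * (c + 1) := Nat.mul_le_mul_left c (by omega)
  nlinarith

end TernaryForms

section TernaryPencils

variable [Fintype K] {n d : ℕ}

omit [Fintype K] in
lemma exists_linearEquiv_apply_eq {u v : Fin n → K} (hu : u ≠ 0) (hv : v ≠ 0) :
    ∃ A : (Fin n → K) ≃ₗ[K] (Fin n → K), A u = v := by
  obtain ⟨A, hA⟩ := Submodule.exists_linearEquiv_restrict_eq
    ((LinearEquiv.toSpanNonzeroSingleton K _ u hu).symm.trans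
      (LinearEquiv.toSpanNonzeroSingleton K _ v hv))
  refine ⟨A, ?_⟩
  have h := hA ⟨u, Submodule.mem_span_singleton_self u⟩
  have h1 : (LinearEquiv.toSpanNonzeroSingleton K _ u hu).symm
      ⟨u, Submodule.mem_span_singleton_self u⟩ = 1 := by
    rw [LinearEquiv.symm_apply_eq]
    exact (LinearEquiv.toSpanNonzeroSingleton_one K _ u hu).symm
  rw [LinearEquiv.trans_apply, h1, LinearEquiv.toSpanNonzeroSingleton_one] at h
  exact h.symm

/-- Through every rational point of a plane curve of degree `d ≤ q + 1` with at least `d q + 1`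
rational points there is a line component. -/
lemma exists_linForm_dvd_through {F : MvPolynomial (Fin 3) K} (hF : F.IsHomogeneous d)
    (hd : 1 ≤ d) (hdq : d ≤ Fintype.card K + 1) {P : Fin 3 → K} (hP : P ≠ 0)
    (h0 : eval P F = 0)
    (hcard : d * Fintype.card K ^ 2 + Fintype.card K ≤
      (zeros F).card + d * Fintype.card K) :
    ∃ a : Fin 3 → K, a ≠ 0 ∧ linMap a P = 0 ∧ linForm a ∣ F := by
  obtain ⟨A, hA⟩ := exists_linearEquiv_apply_eq (u := (Fin.cons 1 0 : Fin 3 → K))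
    (fun h => one_ne_zero (congrFun h 0)) hP
  have hle : (zeros F).card ≤ (zeros (pull A.toLinearMap F)).card := by
    refine Finset.card_le_card_of_injOn A.symm ?_ A.symm.injective.injOn
    intro v hv
    simpa [eval_pull] using hv
  obtain ⟨w, hw, hfib⟩ := exists_fibre_eq_zero (isHomogeneous_pull A.toLinearMap hF) hd hdq
    (by simpa [eval_pull, hA] using h0) (hcard.trans (by gcongr))
  have hpull := pull_lineParam_eq_zero (isHomogeneous_pull A.toLinearMap hF) hfib
  rw [pull_pull] at hpull
  obtain ⟨a, ha, hax, hdvd⟩ := exists_linForm_dvd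
    (A.toLinearMap ∘ₗ lineParam w) (A.injective.comp (lineParam_injective hw)) rfl hpull
  refine ⟨a, ha, ?_, hdvd⟩
  have h := hax ![1, 0]
  rw [← hA]
  simpa [lineParam] using h

lemma card_eq_pow_finrank_of_mem_iff {s : Finset (Fin n → K)} {W : Submodule K (Fin n → K)}
    (h : ∀ v, v ∈ s ↔ v ∈ W) : s.card = Fintype.card K ^ Module.finrank K W := by
  classical
  rw [← Nat.card_eq_fintype_card, ← Module.natCard_eq_pow_finrank, ← Nat.card_eq_finsetCard]
  exact Nat.card_congr (Equiv.subtypeEquivRight h)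

lemma mem_zeros_linForm {a v : Fin n → K} : v ∈ zeros (linForm a) ↔ linMap a v = 0 := by
  rw [mem_zeros, eval_linForm]

omit [Fintype K] in
lemma finrank_ker_linMap {a : Fin 3 → K} (ha : a ≠ 0) :
    Module.finrank K (LinearMap.ker (linMap a)) = 2 := by
  have h1 := LinearMap.finrank_range_add_finrank_ker (linMap a)
  have h2 : LinearMap.range (linMap a) = ⊤ :=
    LinearMap.range_eq_top.2 (LinearMap.surjective fun h => ha (linMap_eq_zero.1 h))
  rw [h2] at h1
  simp at h1
  omega

omit [Fintype K] in
lemma finrank_ker_inf_ker {a b : Fin 3 → K} (ha : a ≠ 0) (hb : b ≠ 0)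
    (hab : LinearMap.ker (linMap a) ≠ LinearMap.ker (linMap b)) :
    Module.finrank K ↥(LinearMap.ker (linMap a) ⊓ LinearMap.ker (linMap b)) = 1 := by
  have h1 := Submodule.finrank_sup_add_finrank_inf_eq (LinearMap.ker (linMap a))
    (LinearMap.ker (linMap b))
  rw [finrank_ker_linMap ha, finrank_ker_linMap hb] at h1
  have h2 := Submodule.finrank_le (LinearMap.ker (linMap a) ⊔ LinearMap.ker (linMap b))
  simp only [Module.finrank_fintype_fun_eq_card, Fintype.card_fin] at h2
  have h3 : LinearMap.ker (linMap a) < LinearMap.ker (linMap a) ⊔ LinearMap.ker (linMap b) := by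
    refine lt_of_le_of_ne le_sup_left fun h => hab ?_
    have hba : LinearMap.ker (linMap b) ≤ LinearMap.ker (linMap a) := h ▸ le_sup_right
    exact (Submodule.eq_of_le_of_finrank_eq hba
      (by rw [finrank_ker_linMap ha, finrank_ker_linMap hb])).symm
  have h4 := Submodule.finrank_lt_finrank_of_lt h3
  rw [finrank_ker_linMap ha] at h4
  omega

lemma card_zeros_linForm {a : Fin 3 → K} (ha : a ≠ 0) :
    (zeros (linForm a)).card = Fintype.card K ^ 2 := by
  rw [← finrank_ker_linMap ha]
  exact card_eq_pow_finrank_of_mem_iff fun v => by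
    rw [mem_zeros_linForm, LinearMap.mem_ker]

lemma card_zeros_linForm_sdiff [DecidableEq K] {a b : Fin 3 → K} (ha : a ≠ 0) (hb : b ≠ 0)
    (hab : LinearMap.ker (linMap a) ≠ LinearMap.ker (linMap b)) :
    (zeros (linForm a) \ zeros (linForm b)).card = Fintype.card K ^ 2 - Fintype.card K := by
  have h : (zeros (linForm b) ∩ zeros (linForm a)).card = Fintype.card K := by
    conv_rhs => rw [← pow_one (Fintype.card K), ← finrank_ker_inf_ker ha hb hab]
    refine card_eq_pow_finrank_of_mem_iff fun v => ?_
    rw [Finset.mem_inter, mem_zeros_linForm, mem_zeros_linForm, Submodule.mem_inf,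
      LinearMap.mem_ker, LinearMap.mem_ker, and_comm]
  rw [Finset.card_sdiff, h, card_zeros_linForm ha]

/-- A ternary form of degree `d ≤ q + 1` with at least `d q + 1` rational zeros has `k` pairwise
non-proportional linear factors for every `k ≤ d`. -/
lemma exists_prod_linForm_dvd {F : MvPolynomial (Fin 3) K} (hF : F.IsHomogeneous d)
    (hd : 1 ≤ d) (hdq : d ≤ Fintype.card K + 1)
    (hcard : d * Fintype.card K ^ 2 + Fintype.card K ≤
      (zeros F).card + d * Fintype.card K) (k : ℕ) (hk : k ≤ d) :
    ∃ m : Fin k → Fin 3 → K, (∀ i, m i ≠ 0) ∧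
      (∀ i j, i ≠ j → LinearMap.ker (linMap (m i)) ≠ LinearMap.ker (linMap (m j))) ∧
      (∏ i, linForm (m i)) ∣ F := by
  classical
  induction k with
  | zero => exact ⟨fun i => i.elim0, fun i => i.elim0, fun i => i.elim0, by simp⟩
  | succ k ih =>
    obtain ⟨m, hm, hne, G, hG⟩ := ih (by omega)
    obtain ⟨v, hv0, hvF, hvm⟩ : ∃ v, v ≠ 0 ∧ eval v F = 0 ∧ ∀ i, linMap (m i) v ≠ 0 := by
      by_contra! hcov
      have hsub : zeros F ⊆
          insert 0 (Finset.univ.biUnion fun i => (zeros (linForm (m i))).erase 0) := by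
        intro v hv
        rw [Finset.mem_insert, or_iff_not_imp_left]
        intro hv0
        obtain ⟨i, hi⟩ := hcov v hv0 (mem_zeros.1 hv)
        exact Finset.mem_biUnion.2 ⟨i, Finset.mem_univ _,
          Finset.mem_erase.2 ⟨hv0, mem_zeros_linForm.2 hi⟩⟩
      have h1 := (Finset.card_le_card hsub).trans
        ((Finset.card_insert_le _ _).trans (Nat.succ_le_succ Finset.card_biUnion_le))
      have h2 : ∀ i, ((zeros (linForm (m i))).erase 0).card = Fintype.card K ^ 2 - 1 := by
        intro i
        rw [Finset.card_erase_of_mem (mem_zeros_linForm.2 (map_zero _)), card_zeros_linForm (hm i)]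
      simp only [h2, Finset.sum_const, Finset.card_univ, Fintype.card_fin, smul_eq_mul] at h1
      have hq : 1 < Fintype.card K := Fintype.one_lt_card
      generalize Fintype.card K = q at *
      obtain ⟨c, rfl⟩ := Nat.exists_eq_add_of_le' hq
      obtain ⟨e, rfl⟩ := Nat.exists_eq_add_of_le' hk
      have h3 : (c + 1 + 1) ^ 2 - 1 = c ^ 2 + 4 * c + 3 := by
        rw [Nat.sub_eq_of_eq_add]; ring
      rw [h3] at h1
      have h4 : c * (e + k) ≤ c * (c + 2) := Nat.mul_le_mul_left c (by omega)
      nlinarith [Nat.zero_le (e * (c ^ 2 + 4 * c + 3))]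
    obtain ⟨a, ha, hav, hdvd⟩ := exists_linForm_dvd_through hF hd hdq hv0 hvF hcard
    have hne' : ∀ i, LinearMap.ker (linMap a) ≠ LinearMap.ker (linMap (m i)) := by
      intro i h
      have : v ∈ LinearMap.ker (linMap (m i)) := h ▸ hav
      exact hvm i this
    refine ⟨Fin.cons a m, ?_, ?_, ?_⟩
    · intro i
      cases i using Fin.cases
      · exact ha
      · exact hm _
    · intro i j hij
      cases i using Fin.cases <;> cases j using Fin.cases
      · exact absurd rfl hij
      · exact hne' _
      · exact (hne' _).symm
      · exact hne _ _ fun h => hij (congrArg Fin.succ h)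
    · obtain ⟨T, S, e, hr, -, hTS⟩ := exists_hyperplane_param ha (finrank_ker_linMap ha)
      have hpullF : pull T F = 0 := by
        obtain ⟨H, rfl⟩ := hdvd
        have h0 : coeffVec (linMap a ∘ₗ T) = 0 := by
          ext i
          have : T (Pi.single i 1) ∈ LinearMap.ker (linMap a) :=
            hr ▸ LinearMap.mem_range_self T _
          exact this
        rw [map_mul, pull_linForm, h0]
        simp [linForm]
      rw [hG, map_mul, map_prod, mul_eq_zero, Finset.prod_eq_zero_iff] at hpullF
      have hpullG : pull T G = 0 := by
        refine hpullF.resolve_left ?_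
        rintro ⟨i, -, hi⟩
        obtain ⟨y, hy⟩ : v ∈ LinearMap.range T := hr ▸ hav
        apply hvm i
        rw [← hy, ← eval_linForm, ← eval_pull, hi, map_zero]
      rw [Fin.prod_univ_succ, hG, mul_comm]
      exact mul_dvd_mul (dvd_refl _) (linForm_dvd_of_pull_eq_zero hTS hpullG)

lemma exists_common_zero {F : MvPolynomial (Fin 3) K} (hd : 2 ≤ d) {m : Fin d → Fin 3 → K}
    (hm : ∀ i, m i ≠ 0)
    (hne : ∀ i j, i ≠ j → LinearMap.ker (linMap (m i)) ≠ LinearMap.ker (linMap (m j)))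
    (hF : ∀ v, eval v F = 0 → ∃ i, linMap (m i) v = 0)
    (hcard : d * Fintype.card K ^ 2 + Fintype.card K ≤
      (zeros F).card + d * Fintype.card K) :
    ∃ P ≠ 0, ∀ i, linMap (m i) P = 0 := by
  classical
  let i₀ : Fin d := ⟨0, by omega⟩
  let i₁ : Fin d := ⟨1, by omega⟩
  have h01 : i₀ ≠ i₁ := by simp [i₀, i₁]
  have hexists : ∀ i j, i ≠ j → ∃ P ≠ 0, linMap (m i) P = 0 ∧ linMap (m j) P = 0 ∧
      ∀ R, linMap (m i) R = 0 → linMap (m j) R = 0 → ∃ c : K, c • P = R := by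
    intro i j hij
    obtain ⟨⟨P, hP⟩, hP0, hspan⟩ :=
      finrank_eq_one_iff'.1 (finrank_ker_inf_ker (hm i) (hm j) (hne i j hij))
    refine ⟨P, fun h => hP0 (Subtype.ext h), hP.1, hP.2, fun R hRi hRj => ?_⟩
    obtain ⟨c, hc⟩ := hspan ⟨R, hRi, hRj⟩
    exact ⟨c, congrArg Subtype.val hc⟩
  obtain ⟨P, hP0, hPi₀, hPi₁, hPspan⟩ := hexists i₀ i₁ h01
  refine ⟨P, hP0, fun j => ?_⟩
  by_contra hj
  have hj0 : j ≠ i₀ := by rintro rfl; exact hj hPi₀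
  have hj1 : j ≠ i₁ := by rintro rfl; exact hj hPi₁
  obtain ⟨R, hR0, hR1, hRj, -⟩ := hexists i₁ j hj1.symm
  have hRi₀ : linMap (m i₀) R ≠ 0 := by
    intro h
    obtain ⟨c, rfl⟩ := hPspan R h hR1
    rw [map_smul, smul_eq_zero] at hRj
    refine hRj.elim (fun hc => hR0 ?_) hj
    rw [hc, zero_smul]
  let Z : Fin d → Finset (Fin 3 → K) := fun i => zeros (linForm (m i))
  let A : Fin d → Finset (Fin 3 → K) := fun i =>
    if i = i₀ then Z i₀ else if i = j then (Z j \ Z i₀).erase R else Z i \ Z i₀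
  have hsub : zeros F ⊆ Finset.univ.biUnion A := by
    intro v hv
    rw [Finset.mem_biUnion]
    by_cases hv0 : v ∈ Z i₀
    · exact ⟨i₀, Finset.mem_univ _, by simpa [A] using hv0⟩
    obtain ⟨i, hi⟩ := hF v (mem_zeros.1 hv)
    have hvi : v ∈ Z i := mem_zeros_linForm.2 hi
    have hi0 : i ≠ i₀ := by rintro rfl; exact hv0 hvi
    by_cases hvR : v = R
    · refine ⟨i₁, Finset.mem_univ _, ?_⟩
      have : v ∈ Z i₁ := mem_zeros_linForm.2 (hvR ▸ hR1)
      simp only [A, if_neg h01.symm, if_neg hj1.symm, Finset.mem_sdiff]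
      exact ⟨this, hv0⟩
    · refine ⟨i, Finset.mem_univ _, ?_⟩
      by_cases hij : i = j
      · subst hij
        simp only [A, if_neg hi0, if_pos, Finset.mem_erase, Finset.mem_sdiff]
        exact ⟨hvR, hvi, hv0⟩
      · simp only [A, if_neg hi0, if_neg hij, Finset.mem_sdiff]
        exact ⟨hvi, hv0⟩
  have hsdiff : ∀ i, i ≠ i₀ → (Z i \ Z i₀).card = Fintype.card K ^ 2 - Fintype.card K :=
    fun i hi => card_zeros_linForm_sdiff (hm i) (hm i₀) (hne i i₀ hi)
  have hA0 : (A i₀).card = Fintype.card K ^ 2 := by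
    simp only [A, if_pos]
    exact card_zeros_linForm (hm i₀)
  have hlt : ∑ i ∈ Finset.univ.erase i₀, (A i).card <
      ∑ _i ∈ Finset.univ.erase i₀, (Fintype.card K ^ 2 - Fintype.card K) := by
    refine Finset.sum_lt_sum (fun i hi => ?_) ⟨j, by simp [hj0], ?_⟩
    · have hi0 := Finset.ne_of_mem_erase hi
      rw [← hsdiff i hi0]
      refine Finset.card_le_card ?_
      by_cases hij : i = j
      · subst hij
        simp only [A, if_neg hi0, if_pos]
        exact Finset.erase_subset _ _
      · simp only [A, if_neg hi0, if_neg hij]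
        exact Finset.Subset.refl _
    · rw [← hsdiff j hj0]
      simp only [A, if_neg hj0, if_pos]
      exact Finset.card_erase_lt_of_mem
        (Finset.mem_sdiff.2 ⟨mem_zeros_linForm.2 hRj, fun h => hRi₀ (mem_zeros_linForm.1 h)⟩)
  have hle := (Finset.card_le_card hsub).trans Finset.card_biUnion_le
  rw [← Finset.add_sum_erase _ _ (Finset.mem_univ i₀), hA0] at hle
  rw [Finset.sum_const, Finset.card_erase_of_mem (Finset.mem_univ _), Finset.card_univ,
    Fintype.card_fin, smul_eq_mul] at hlt
  have hq : 1 ≤ Fintype.card K := Fintype.card_pos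
  generalize Fintype.card K = q at *
  obtain ⟨c, rfl⟩ := Nat.exists_eq_add_of_le' hq
  obtain ⟨e, rfl⟩ := Nat.exists_eq_add_of_le' hd
  have h1 : (c + 1) ^ 2 - (c + 1) = c ^ 2 + c := by
    rw [Nat.sub_eq_of_eq_add]; ring
  rw [h1, show e + 2 - 1 = e + 1 by omega] at hlt
  nlinarith

/-- The equality case of the bound `d q + 1` for the number of rational points of a plane curve of
degree `d ≤ q + 1`: the curve is a pencil of `d` lines. -/
lemma exists_pencil {F : MvPolynomial (Fin 3) K} (hF : F.IsHomogeneous d) (hF0 : F ≠ 0)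
    (hd : 2 ≤ d) (hdq : d ≤ Fintype.card K + 1)
    (hcard : d * Fintype.card K ^ 2 + Fintype.card K ≤
      (zeros F).card + d * Fintype.card K) :
    ∃ (c : K) (m : Fin d → Fin 3 → K) (P : Fin 3 → K), c ≠ 0 ∧ P ≠ 0 ∧
      F = C c * ∏ i, linForm (m i) ∧ (∀ i, m i ≠ 0) ∧
      (∀ i j, i ≠ j → LinearMap.ker (linMap (m i)) ≠ LinearMap.ker (linMap (m j))) ∧
      ∀ i, linMap (m i) P = 0 := by
  obtain ⟨m, hm, hne, G, hG⟩ :=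
    exists_prod_linForm_dvd hF (by omega) hdq hcard d le_rfl
  have hprod : (∏ i, linForm (m i)).IsHomogeneous d := by
    simpa using IsHomogeneous.prod Finset.univ (fun i => linForm (m i)) (fun _ => 1)
      fun i _ => isHomogeneous_linForm (m i)
  have hprod0 : (∏ i, linForm (m i)) ≠ 0 := by
    rintro h
    rw [h, zero_mul] at hG
    exact hF0 hG
  have hG0 : G ≠ 0 := by
    rintro rfl
    rw [mul_zero] at hG
    exact hF0 hG
  have hdeg := totalDegree_mul_of_isDomain hprod0 hG0
  rw [← hG, hF.totalDegree hF0, hprod.totalDegree hprod0] at hdeg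
  obtain ⟨c, rfl⟩ : ∃ c, G = C c := ⟨_, totalDegree_eq_zero_iff_eq_C.1 (by omega)⟩
  have hc : c ≠ 0 := by
    rintro rfl
    exact hG0 C_0
  obtain ⟨P, hP0, hP⟩ := exists_common_zero (F := F) hd hm hne (fun v hv => by
    rw [hG, map_mul, map_prod, eval_C, mul_eq_zero, Finset.prod_eq_zero_iff] at hv
    obtain ⟨i, -, hi⟩ := hv.resolve_right hc
    exact ⟨i, by rwa [eval_linForm] at hi⟩) hcard
  exact ⟨c, m, P, hc, hP0, by rw [hG, mul_comm], hm, hne, hP⟩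

end TernaryPencils

section SurfaceCount

variable [Fintype K] {n d : ℕ}

omit [Fintype K] in
lemma eval_smul_of_isHomogeneous {F : MvPolynomial (Fin n) K} (hF : F.IsHomogeneous d) (c : K)
    (v : Fin n → K) : eval (c • v) F = c ^ d * eval v F := by
  rw [eval_eq', eval_eq', Finset.mul_sum]
  refine Finset.sum_congr rfl fun δ hδ => ?_
  have h : ∑ i, δ i = d := by
    have h1 := hF.coeff_eq_zero (d := δ)
    rw [not_imp_comm] at h1
    simpa [Finsupp.degree_eq_sum] using h1 (by simpa using hδ)
  simp only [Pi.smul_apply, smul_eq_mul, mul_pow, Finset.prod_mul_distrib]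
  rw [Finset.prod_pow_eq_pow_sum, h]
  ring

lemma card_projective_zeros_le {F : MvPolynomial (Fin n) K} (hF : F.IsHomogeneous d)
    (hd : d ≠ 0) :
    Nat.card {p : Projectivization K (Fin n → K) // eval p.rep F = 0} *
      (Fintype.card K - 1) + 1 ≤ (zeros F).card := by
  classical
  have h0 : (0 : Fin n → K) ∈ zeros F := by
    rw [mem_zeros, ← zero_smul K (0 : Fin n → K), eval_smul_of_isHomogeneous hF, zero_pow hd,
      zero_mul]
  rw [← Finset.card_erase_add_one h0]
  refine Nat.add_le_add_right ?_ 1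
  rw [← Fintype.card_units, ← Nat.card_eq_fintype_card, ← Nat.card_prod,
    ← Nat.card_eq_finsetCard]
  refine Nat.card_le_card_of_injective
    (fun x => ⟨(x.2 : K) • x.1.1.rep, ?_⟩) ?_
  · refine Finset.mem_erase.2 ⟨smul_ne_zero x.2.ne_zero x.1.1.rep_nonzero, ?_⟩
    rw [mem_zeros, eval_smul_of_isHomogeneous hF, x.1.2, mul_zero]
  · rintro ⟨⟨p, hp⟩, u⟩ ⟨⟨p', hp'⟩, u'⟩ h
    have h' : (u : K) • p.rep = (u' : K) • p'.rep := congrArg Subtype.val h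
    have hpp : p = p' := by
      rw [← p.mk_rep, ← p'.mk_rep, Projectivization.mk_eq_mk_iff]
      refine ⟨u⁻¹ * u', ?_⟩
      rw [mul_smul, inv_smul_eq_iff]
      exact h'.symm
    subst hpp
    have huu : u = u' := Units.ext (smul_left_injective K p.rep_nonzero h')
    rw [huu]

/-- A ternary form of degree `d ≤ q` vanishing on the line `X₀ = 0` has at most `(d - 1) q`
rational zeros on the affine plane `X₀ = 1`. -/
lemma card_affine_zeros_le [DecidableEq K] {F : MvPolynomial (Fin 3) K} (hF : F.IsHomogeneous d)
    (hF0 : F ≠ 0) (hdq : d ≤ Fintype.card K)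
    (hl : ∀ x : Fin 2 → K, eval (Fin.cons 0 x : Fin 3 → K) F = 0) :
    (Finset.univ.filter fun x : Fin 2 → K => eval (Fin.cons 1 x : Fin 3 → K) F = 0).card ≤
      (d - 1) * Fintype.card K := by
  set c : ℕ → MvPolynomial (Fin 2) K := fun k => (finSuccEquiv K 2 F).coeff k with hc
  have hhom : ∀ k ≤ d, (c k).IsHomogeneous (d - k) := fun k hk =>
    hF.finSuccEquiv_coeff_isHomogeneous k (d - k) (by omega)
  have hc0 : c 0 = 0 := by
    refine (hhom 0 (Nat.zero_le d)).eq_zero_of_forall_eval_eq_zero_of_le_card (fun x => ?_) ?_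
    · rw [← hl x, ← eval_fibre, ← Polynomial.coeff_zero_eq_eval_zero]
      simp [fibre, hc]
    · simpa using hdq
  set g : MvPolynomial (Fin 2) K := (finSuccEquiv K 2 F).eval 1 with hg
  have hgsum : g = ∑ k ∈ Finset.range (d + 1), c k := by
    rw [hg, Polynomial.eval_eq_sum_range' (n := d + 1)]
    · simp [hc]
    · refine Nat.lt_succ_of_le (Polynomial.natDegree_le_iff_coeff_eq_zero.2 fun k hk => ?_)
      exact coeff_finSuccEquiv_eq_zero hF hk
  have hgeval : ∀ x, eval x g = eval (Fin.cons 1 x : Fin 3 → K) F := by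
    intro x
    rw [← eval_fibre, fibre, Polynomial.eval_one_map]
  have hgdeg : g.totalDegree ≤ d - 1 := by
    rw [hgsum]
    refine totalDegree_finsetSum_le fun k hk => ?_
    rcases Nat.eq_zero_or_pos k with rfl | hk0
    · simp [hc0]
    · have := (hhom k (by simpa [Nat.lt_succ_iff] using hk)).totalDegree_le
      omega
  have hg0 : g ≠ 0 := by
    intro h
    refine hF0 ((finSuccEquiv K 2).injective ?_)
    rw [map_zero]
    ext1 k
    rw [Polynomial.coeff_zero]
    rcases lt_or_ge d k with hk | hk
    · exact coeff_finSuccEquiv_eq_zero hF hk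
    · have h1 := congrArg (homogeneousComponent (d - k)) (hgsum.symm.trans h)
      rw [map_sum, map_zero, Finset.sum_eq_single k] at h1
      · rwa [homogeneousComponent_eq_self (hhom k hk)] at h1
      · intro j hj hjk
        have hj : j ≤ d := by simpa [Nat.lt_succ_iff] using hj
        rw [homogeneousComponent_of_mem (hhom j hj), if_neg (by omega)]
      · intro hk'
        simp at hk'
        omega
  have hsz := schwartz_zippel_totalDegree hg0 (Finset.univ : Finset K)
  have hq : (0 : ℚ≥0) < Fintype.card K := by exact_mod_cast Fintype.card_pos
  rw [Fintype.piFinset_univ, Finset.card_univ, div_le_div_iff₀ (by positivity) hq] at hsz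
  simp only [hgeval] at hsz
  have hsz' : (Finset.univ.filter fun x : Fin 2 → K =>
      eval (Fin.cons 1 x : Fin 3 → K) F = 0).card * Fintype.card K ≤
      (g.totalDegree * Fintype.card K) * Fintype.card K := by
    rw [mul_assoc, ← pow_two]
    exact_mod_cast hsz
  exact (Nat.le_of_mul_le_mul_right hsz' Fintype.card_pos).trans (Nat.mul_le_mul_right _ hgdeg)

lemma sum_card_coset_zeros [DecidableEq K] (F : MvPolynomial (Fin n) K)
    (t : (Fin 2 → K) →ₗ[K] (Fin n → K)) (s : Finset (Fin n → K))
    (hs : ∀ v x, v ∈ s → v + t x ∈ s) :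
    ∑ v ∈ s, (Finset.univ.filter fun x => eval (v + t x) F = 0).card =
      Fintype.card K ^ 2 * (s.filter fun v => eval v F = 0).card := by
  simp only [Finset.card_filter]
  rw [Finset.sum_comm]
  have h : ∀ x, ∑ v ∈ s, (if eval (v + t x) F = 0 then 1 else 0) =
      ∑ v ∈ s, (if eval v F = 0 then 1 else 0) := by
    intro x
    refine Finset.sum_bij' (fun v _ => v + t x) (fun v _ => v - t x) ?_ ?_ ?_ ?_ ?_
    · exact fun v hv => hs v x hv
    · intro v hv
      simpa [sub_eq_add_neg] using hs v (-x) hv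
    · simp
    · simp
    · simp
  simp only [h]
  simp

/-- Lower bound for the number of zeros on a hyperplane through a line contained in a surface. -/
lemma le_card_section [DecidableEq K] {F : MvPolynomial (Fin 4) K} (hF : F.IsHomogeneous d)
    (hpl : ∀ T : (Fin 3 → K) →ₗ[K] (Fin 4 → K), Function.Injective T → pull T F ≠ 0)
    (hdq : d ≤ Fintype.card K) {t : (Fin 2 → K) →ₗ[K] (Fin 4 → K)}
    (ht : Function.Injective t) (htF : ∀ x, eval (t x) F = 0) {s : Finset (Fin 4 → K)}
    {H : Submodule K (Fin 4 → K)} (hs : ∀ v, v ∈ s ↔ v ∈ H) (hH : Module.finrank K H = 3)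
    (htH : ∀ x, t x ∈ H) :
    (zeros F).card ≤ (s.filter fun v => eval v F = 0).card +
      (Fintype.card K ^ 2 - Fintype.card K) * ((d - 1) * Fintype.card K) := by
  have hcoset : ∀ v ∉ H, (Finset.univ.filter fun x => eval (v + t x) F = 0).card ≤
      (d - 1) * Fintype.card K := by
    intro v hv
    let T : (Fin 3 → K) →ₗ[K] (Fin 4 → K) :=
      (LinearMap.proj 0).smulRight v + t ∘ₗ LinearMap.funLeft K K Fin.succ
    have hTcons : ∀ (y : K) (x : Fin 2 → K), T (Fin.cons y x : Fin 3 → K) = y • v + t x := by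
      intro y x
      have : LinearMap.funLeft K K Fin.succ (Fin.cons y x : Fin 3 → K) = x := by
        ext i
        simp [LinearMap.funLeft_apply]
      simp [T, this]
    have hT : Function.Injective T := by
      rw [← LinearMap.ker_eq_bot, LinearMap.ker_eq_bot']
      intro y hy
      rw [← Fin.cons_self_tail y, hTcons] at hy
      have hy0 : y 0 = 0 := by
        by_contra h
        refine hv ?_
        rw [← inv_smul_smul₀ h v, eq_neg_of_add_eq_zero_left hy]
        exact H.smul_mem _ (H.neg_mem (htH _))
      rw [hy0, zero_smul, zero_add] at hy
      have hy1 : Fin.tail y = 0 := ht (hy.trans (map_zero t).symm)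
      rw [← Fin.cons_self_tail y, hy0, hy1]
      ext i
      cases i using Fin.cases <;> simp
    have h := card_affine_zeros_le (isHomogeneous_pull T hF) (hpl T hT) hdq fun x => by
      rw [eval_pull, hTcons, zero_smul, zero_add, htF]
    simpa only [eval_pull, hTcons, one_smul] using h
  have hall := sum_card_coset_zeros F t Finset.univ fun _ _ _ => Finset.mem_univ _
  have hsec := sum_card_coset_zeros F t s fun v x hv =>
    (hs _).2 (H.add_mem ((hs v).1 hv) (htH x))
  rw [← Finset.sum_add_sum_compl s, hsec] at hall
  have hcompl : ∑ v ∈ sᶜ, (Finset.univ.filter fun x => eval (v + t x) F = 0).card ≤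
      (Fintype.card K ^ 4 - Fintype.card K ^ 3) * ((d - 1) * Fintype.card K) := by
    refine (Finset.sum_le_card_nsmul _ _ _ fun v hv => hcoset v ?_).trans_eq ?_
    · rwa [← hs, ← Finset.mem_compl]
    · rw [Finset.card_compl, card_eq_pow_finrank_of_mem_iff hs, hH]
      simp
  have hz : (Finset.univ.filter fun v => eval v F = 0) = zeros F := by
    ext
    simp
  rw [hz] at hall
  have hpow : Fintype.card K ^ 4 - Fintype.card K ^ 3 =
      Fintype.card K ^ 2 * (Fintype.card K ^ 2 - Fintype.card K) := by
    rw [Nat.mul_sub]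
    ring_nf
  rw [hpow, mul_assoc] at hcompl
  refine Nat.le_of_mul_le_mul_left ?_ (pow_pos (Fintype.card_pos (α := K)) 2)
  rw [← hall, mul_add]
  exact Nat.add_le_add_left hcompl _

end SurfaceCount

section PencilSections

variable {d : ℕ}

/-- A planar pencil structure on the pullback of `F` to a parametrized plane descends to `F`. -/
lemma isPencil_of_pull_eq {F : MvPolynomial (Fin 4) K} {a : Fin 4 → K} (ha : a ≠ 0)
    {T : (Fin 3 → K) →ₗ[K] (Fin 4 → K)} {S : (Fin 4 → K) →ₗ[K] (Fin 3 → K)} {e : Fin 4 → K}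
    (hT : LinearMap.range T = LinearMap.ker (linMap a)) (hST : ∀ x, S (T x) = x)
    (hTS : ∀ x, x - T (S x) = linMap a x • e) {c : K} {m : Fin d → Fin 3 → K} {P : Fin 3 → K}
    (hc : c ≠ 0) (hP : P ≠ 0) (hF : pull T F = C c * ∏ i, linForm (m i)) (hm : ∀ i, m i ≠ 0)
    (hne : ∀ i j, i ≠ j → LinearMap.ker (linMap (m i)) ≠ LinearMap.ker (linMap (m j)))
    (hmP : ∀ i, linMap (m i) P = 0) :
    ∃ Q : Projectivization K (Fin 4 → K), IsPencil F d (LinearMap.ker (linMap a)) Q := by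
  have hinj : Function.Injective T := Function.LeftInverse.injective hST
  have hTP : T P ≠ 0 := fun h => hP (hinj (h.trans (map_zero T).symm))
  have haT (x) : linMap a (T x) = 0 := by
    rw [← LinearMap.mem_ker, ← hT]
    exact LinearMap.mem_range_self T x
  have hker (i) : LinearMap.ker (linMap a) ⊓
      LinearMap.ker (linMap (coeffVec (linMap (m i) ∘ₗ S))) =
      (LinearMap.ker (linMap (m i))).map T := by
    ext v
    rw [← hT, linMap_coeffVec, Submodule.mem_inf, Submodule.mem_map]
    constructor
    · rintro ⟨⟨x, rfl⟩, hx⟩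
      refine ⟨x, ?_, rfl⟩
      simpa [hST] using hx
    · rintro ⟨x, hx, rfl⟩
      refine ⟨⟨x, rfl⟩, ?_⟩
      simpa [hST] using hx
  obtain ⟨g, hg⟩ := linForm_dvd_sub_pull hTS F
  obtain ⟨u, hu⟩ := Projectivization.exists_smul_eq_mk_rep K (T P) hTP
  refine ⟨Projectivization.mk K (T P) hTP, a, fun i => coeffVec (linMap (m i) ∘ₗ S), c, g, ha,
    rfl, hc, ?_, fun i => ?_, fun i j hij h => hne i j hij ?_, ?_, fun i => ?_⟩
  · rw [hF, map_mul, map_prod, algHom_C, algebraMap_eq] at hg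
    simp only [pull_linForm] at hg
    rw [← hg]
    ring
  · rw [IsLine, hker, (Submodule.equivMapOfInjective T hinj _).symm.finrank_eq,
      finrank_ker_linMap (hm i)]
  · rw [hker, hker] at h
    exact Submodule.map_injective_of_injective hinj h
  · rw [← hu, LinearMap.mem_ker, Units.smul_def, map_smul, haT, smul_zero]
  · rw [← hu, Units.smul_def, map_smul, linMap_coeffVec, LinearMap.comp_apply, hST, hmP, smul_zero]

/-- The plane sections of `S` through a line of `S` have at least `d * q + 1` points. -/
lemma le_card_zeros_pull [Fintype K] {F : MvPolynomial (Fin 4) K} (hhom : F.IsHomogeneous d)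
    (hpl : ∀ T : (Fin 3 → K) →ₗ[K] (Fin 4 → K), Function.Injective T → pull T F ≠ 0)
    (hd2 : 2 ≤ d) (hdq : d ≤ Fintype.card K + 1)
    (hN : Nat.card {p : Projectivization K (Fin 4 → K) // eval p.rep F = 0} =
      (d - 1) * Fintype.card K ^ 2 + d * Fintype.card K + 1)
    {l H : Submodule K (Fin 4 → K)} (hl : IsLine l) (hlS : ∀ v ∈ l, eval v F = 0)
    (hH : IsPlane H) (hlH : l ≤ H) {T : (Fin 3 → K) →ₗ[K] (Fin 4 → K)}
    (hT : LinearMap.range T = H) :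
    d * Fintype.card K ^ 2 + Fintype.card K ≤
      (zeros (pull T F)).card + d * Fintype.card K := by
  classical
  have hcard := card_projective_zeros_le hhom (by omega)
  rw [hN] at hcard
  have hq : 1 < Fintype.card K := Fintype.one_lt_card
  obtain ⟨e, rfl⟩ : ∃ e, d = e + 1 := ⟨d - 1, by omega⟩
  obtain hdq' | hdq' : e + 1 = Fintype.card K + 1 ∨ e + 1 ≤ Fintype.card K := by omega
  · have hall : zeros F = Finset.univ := by
      refine Finset.eq_univ_of_card _ (le_antisymm (Finset.card_le_univ _) ?_)
      refine le_trans (le_of_eq ?_) hcard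
      obtain ⟨q, hq'⟩ : ∃ q, Fintype.card K = q + 1 := ⟨_, (Nat.succ_pred (by omega)).symm⟩
      rw [hdq', Fintype.card_pi_const, hq', Nat.add_sub_cancel, Nat.add_sub_cancel]
      ring
    have hall' : zeros (pull T F) = Finset.univ := by
      refine Finset.eq_univ_of_forall fun x => ?_
      rw [mem_zeros, eval_pull, ← mem_zeros, hall]
      exact Finset.mem_univ _
    rw [hall', hdq', Finset.card_univ, Fintype.card_pi_const]
    exact le_of_eq (by ring)
  · let t : (Fin 2 → K) →ₗ[K] (Fin 4 → K) := l.subtype ∘ₗ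
      (LinearEquiv.ofFinrankEq (Fin 2 → K) l (by rw [hl]; simp) : (Fin 2 → K) →ₗ[K] l)
    have ht (x) : t x ∈ l := Subtype.property _
    have h := le_card_section (F := F) hhom hpl hdq' (t := t)
      (l.injective_subtype.comp (LinearEquiv.injective _)) (fun x => hlS _ (ht x))
      (s := Finset.univ.filter (· ∈ H)) (H := H) (by simp) hH fun x => hlH (ht x)
    have h2 : ((Finset.univ.filter (· ∈ H)).filter fun v => eval v F = 0).card ≤
        (zeros (pull T F)).card := by
      refine (Finset.card_le_card ?_).trans (Finset.card_image_le (f := T))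
      intro v hv
      simp only [Finset.mem_filter, Finset.mem_univ, true_and, ← hT] at hv
      obtain ⟨⟨x, rfl⟩, hx⟩ := hv
      refine Finset.mem_image_of_mem T ?_
      rwa [mem_zeros, eval_pull]
    obtain ⟨q, hq'⟩ : ∃ q, Fintype.card K = q + 1 := ⟨_, (Nat.succ_pred (by omega)).symm⟩
    rw [hq'] at h hcard ⊢
    have h3 : (q + 1) ^ 2 - (q + 1) = q * (q + 1) := by
      rw [Nat.sub_eq_iff_eq_add (by nlinarith)]
      ring
    rw [h3] at h
    simp only [Nat.add_sub_cancel] at h hcard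
    nlinarith

end PencilSections

/-- Let `S` be a surface of degree `d` (`2 ≤ d ≤ q+1`) in `P^3` over
`F_q` without `F_q`-plane components attaining the elementary bound. If `l` is an
`F_q`-line contained in `S` and `H` is an `F_q`-plane containing `l`, then `S ∩ H` is a
planar `F_q`-pencil of degree `d`. -/
theorem plane_through_line_cuts_pencil (K : Type) [Field K] [Fintype K]
    (d : ℕ) (F : MvPolynomial (Fin 4) K)
    (hhom : F.IsHomogeneous d) (hsf : Squarefree F)
    (hnoplane : ¬ ∃ a : Fin 4 → K, a ≠ 0 ∧ linForm a ∣ F)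
    (hd2 : 2 ≤ d) (hdq : d ≤ Fintype.card K + 1)
    (hN : Nat.card {p : Projectivization K (Fin 4 → K) // MvPolynomial.eval p.rep F = 0} =
      (d - 1) * Fintype.card K ^ 2 + d * Fintype.card K + 1)
    (l : Submodule K (Fin 4 → K)) (hl : IsLine l)
    (hlS : ∀ v ∈ l, MvPolynomial.eval v F = 0)
    (H : Submodule K (Fin 4 → K)) (hH : IsPlane H) (hlH : l ≤ H) :
    ∃ P : Projectivization K (Fin 4 → K), IsPencil F d H P := by
  have hpl (T : (Fin 3 → K) →ₗ[K] (Fin 4 → K)) (hT : Function.Injective T) : pull T F ≠ 0 := by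
    intro h
    obtain ⟨a, ha, -, hdvd⟩ := exists_linForm_dvd T hT rfl h
    exact hnoplane ⟨a, ha, hdvd⟩
  obtain ⟨a, ha, rfl⟩ := exists_eq_ker_linMap hH rfl
  obtain ⟨T, S, e, hT, hST, hTS⟩ := exists_hyperplane_param ha hH
  have hinj : Function.Injective T := Function.LeftInverse.injective hST
  obtain ⟨c, m, P, hc, hP, hF, hm, hne, hmP⟩ := exists_pencil (isHomogeneous_pull T hhom)
    (hpl T hinj) hd2 hdq (le_card_zeros_pull hhom hpl hd2 hdq hN hl hlS hH hlH hT)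
  exact isPencil_of_pull_eq ha hT hST hTS hc hP hF hm hne hmP
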